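/- arXiv:2207.03115 — 3 statements merged into one kernel-verified Lean document; each statement's English description precedes it below -/
import Mathlib

section
/- Let Λ ⊂ U be a Lagrangian subspace of a finite-dimensional complex symplectic vector space U with symplectic form ω. Let σ : U → U be a linear involution respecting the symplectic form, but not necessarily preserving Λ. Suppose that the subspace Λ ∩ U^σ is Lagrangian in the symplectic vector space U^σ (with respect to the restriction of ω to U^σ). Then σ(Λ) = Λ. -/
/-- Lemma "elementary". Let `Λ ⊂ U` be a Lagrangian subspace of a
finite-dimensional complex symplectic vector space `(U, ω)`, and let `σ` be a linear involution
of `U` respecting `ω` (but not necessarily preserving `Λ`). If the subspace `Λ ∩ U^σ`, viewed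
inside the symplectic space `U^σ = ker (σ - id)`, is Lagrangian for the restriction of `ω`,
then `σ(Λ) = Λ`. -/
theorem involution_preserves_lagrangian_of_fixed_part_lagrangian
    {U : Type*} [AddCommGroup U] [Module ℂ U] [FiniteDimensional ℂ U]
    (ω : LinearMap.BilinForm ℂ U) (hAlt : ω.IsAlt) (hNondeg : ω.Nondegenerate)
    (σ : U →ₗ[ℂ] U) (hInv : σ ∘ₗ σ = LinearMap.id)
    (hσω : ∀ x y : U, ω (σ x) (σ y) = ω x y)
    (Λ : Submodule ℂ U) (hΛ : Λ = ω.orthogonal Λ)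
    (hLag : Submodule.comap (LinearMap.ker (σ - LinearMap.id)).subtype Λ =
      (ω.restrict (LinearMap.ker (σ - LinearMap.id))).orthogonal
        (Submodule.comap (LinearMap.ker (σ - LinearMap.id)).subtype Λ)) :
    Λ.map σ = Λ := by
  have hσσ : ∀ x, σ (σ x) = x := fun x => LinearMap.congr_fun hInv x
  have hmem : ∀ x ∈ Λ, σ x ∈ Λ := by
    intro x hx
    have hfix : x + σ x ∈ LinearMap.ker (σ - LinearMap.id) := by
      simp [hσσ, add_comm]
    have hsum : (⟨x + σ x, hfix⟩ : LinearMap.ker (σ - LinearMap.id)) ∈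
        Submodule.comap (LinearMap.ker (σ - LinearMap.id)).subtype Λ := by
      rw [hLag, LinearMap.BilinForm.mem_orthogonal_iff]
      rintro ⟨y, hy⟩ hyΛ
      have hyσ : σ y = y := by simpa [sub_eq_zero] using hy
      have hyx : ω y x = 0 := by
        rw [hΛ] at hx
        exact hx y hyΛ
      have hyσx : ω y (σ x) = 0 := by
        rw [← hyσ, hσω, hyx]
      change ω y (x + σ x) = 0
      rw [map_add, hyx, hyσx, add_zero]
    exact (Submodule.add_mem_iff_right Λ hx).mp hsum
  refine le_antisymm (Submodule.map_le_iff_le_comap.mpr hmem) fun x hx => ?_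
  exact ⟨σ x, hmem x hx, hσσ x⟩
end

section
/- Let 𝔤 be a finite-dimensional complex Lie algebra whose Killing form κ is nondegenerate, and let (e, h, f) be an sl₂-triple in 𝔤 with e ≠ 0. Let 𝔤_{−1} denote the eigenspace of ad h with eigenvalue −1. Then the bilinear form on 𝔤_{−1} defined by (x, y) ↦ κ(e, ⁅x, y⁆) is alternating and nondegenerate; that is, 𝔤_{−1} carries a canonical symplectic form. -/
namespace IsSl2Triple

variable {L M : Type*} [LieRing L] [LieAlgebra ℂ L] [AddCommGroup M] [Module ℂ M]
  [LieRingModule L M] [LieModule ℂ L M] [FiniteDimensional ℂ M] {h e f : L}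

open LieModule Module.End

lemma exists_pow_toEnd_e_eq_zero (t : IsSl2Triple h e f) {m : M} {μ : ℂ} (hm : ⁅h, m⁆ = μ • m) :
    ∃ k : ℕ, ((toEnd ℂ L M e) ^ k) m = 0 := by
  by_contra! contra
  have h_inj : Function.Injective fun k : ℕ ↦ μ + 2 * (k : ℂ) := fun a b hab ↦ by
    simpa using hab
  have hv := (toEnd ℂ L M h).eigenvectors_linearIndependent' _ h_inj
    (fun k ↦ ((toEnd ℂ L M e) ^ k) m) fun k ↦
      ⟨by rw [mem_eigenspace_iff, toEnd_apply_apply]; exact t.lie_h_pow_toEnd_e hm k, contra k⟩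
  exact not_finite_iff_infinite.mpr (inferInstanceAs (Infinite ℕ)) hv.finite

/-- On a weight space of positive integral weight, the composite `e ∘ f` is injective. -/
lemma eq_zero_of_lie_e_lie_f_eq_zero (t : IsSl2Triple h e f) {z : M} {n : ℕ}
    (hz : ⁅h, z⁆ = (n + 1 : ℂ) • z) (hefz : ⁅e, ⁅f, z⁆⁆ = 0) : z = 0 := by
  by_contra hz₀
  have hf (k : ℕ) : ⁅f, ((toEnd ℂ L M e) ^ (k + 1)) z⁆ =
      (-((k + 1) * (n + 1 + k)) : ℂ) • ((toEnd ℂ L M e) ^ k) z := by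
    have hfe (w : M) : ⁅f, ⁅e, w⁆⁆ = ⁅e, ⁅f, w⁆⁆ - ⁅h, w⁆ := by
      rw [leibniz_lie e f w, t.lie_e_f]; abel
    induction k with
    | zero =>
      simp only [zero_add, pow_one, pow_zero, toEnd_apply_apply, Module.End.one_apply, hfe, hefz, hz]
      push_cast
      module
    | succ k ih =>
      rw [← lie_e_pow_toEnd_e (k + 1), hfe, ih, lie_smul, lie_e_pow_toEnd_e,
        t.lie_h_pow_toEnd_e hz, ← sub_smul]
      congr 1
      push_cast
      ring
  obtain ⟨k, hk, hk'⟩ := Nat.exists_not_and_succ_of_not_zero_of_exists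
    (p := fun k ↦ ((toEnd ℂ L M e) ^ k) z = 0) (by simpa using hz₀)
    (t.exists_pow_toEnd_e_eq_zero hz)
  have := hf k
  rw [hk', lie_zero, eq_comm, smul_eq_zero_iff_left hk] at this
  norm_cast at this
  simp at this

/-- On a weight space of negative integral weight, the composite `f ∘ e` is injective. -/
lemma eq_zero_of_lie_f_lie_e_eq_zero (t : IsSl2Triple h e f) {z : M} {n : ℕ}
    (hz : ⁅h, z⁆ = (-(n + 1) : ℂ) • z) (hfez : ⁅f, ⁅e, z⁆⁆ = 0) : z = 0 :=
  t.symm.eq_zero_of_lie_e_lie_f_eq_zero (n := n) (by rw [neg_lie, hz, neg_smul, neg_neg]) hfez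

/-- The operator `e` maps the weight space of weight `n - 1` onto that of weight `n + 1`. -/
lemma exists_lie_e_eq (t : IsSl2Triple h e f) {z : M} {n : ℕ}
    (hz : ⁅h, z⁆ = (n + 1 : ℂ) • z) : ∃ u : M, ⁅h, u⁆ = (n - 1 : ℂ) • u ∧ ⁅e, u⁆ = z := by
  have hf {w : M} (hw : ⁅h, w⁆ = (n + 1 : ℂ) • w) : ⁅h, ⁅f, w⁆⁆ = (n - 1 : ℂ) • ⁅f, w⁆ := by
    rw [leibniz_lie, t.lie_lie_smul_f ℂ, hw, neg_lie, smul_lie, lie_smul]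
    module
  let E := (toEnd ℂ L M h).eigenspace (n + 1)
  have hE {w : M} : w ∈ E ↔ ⁅h, w⁆ = (n + 1 : ℂ) • w := mem_eigenspace_iff
  let ef : E →ₗ[ℂ] E := (toEnd ℂ L M e ∘ₗ toEnd ℂ L M f).restrict fun w hw ↦ by
    rw [hE] at hw ⊢
    simp only [LinearMap.comp_apply, toEnd_apply_apply]
    rw [leibniz_lie, t.lie_h_e_smul ℂ, hf hw, smul_lie, lie_smul]
    module
  have hinj : Function.Injective ef := by
    refine (injective_iff_map_eq_zero ef).mpr fun w hw ↦ Subtype.ext ?_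
    exact t.eq_zero_of_lie_e_lie_f_eq_zero (hE.mp w.2) (congrArg Subtype.val hw)
  obtain ⟨w, hw⟩ := LinearMap.injective_iff_surjective.mp hinj ⟨z, hE.mpr hz⟩
  exact ⟨⁅f, (w : M)⁆, hf (hE.mp w.2), congrArg Subtype.val hw⟩

/-- A generalized weight vector of rank at most two killed by `e` is a weight vector. -/
lemma eq_zero_of_lie_h_eq_add (t : IsSl2Triple h e f) {v y : M} {μ : ℂ}
    (hv : ⁅h, v⁆ = μ • v) (hev : ⁅e, v⁆ = 0) (hy : ⁅h, y⁆ = μ • y + v) (hey : ⁅e, y⁆ = 0) :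
    v = 0 := by
  by_contra hv₀
  have P : t.HasPrimitiveVectorWith v μ := ⟨hv₀, hv, hev⟩
  obtain ⟨n, rfl⟩ := P.exists_nat
  have hh (k : ℕ) : ⁅h, ((toEnd ℂ L M f) ^ k) y⁆ =
      (n - 2 * k : ℂ) • ((toEnd ℂ L M f) ^ k) y + ((toEnd ℂ L M f) ^ k) v := by
    induction k with
    | zero => simpa using hy
    | succ k ih =>
      simp only [pow_succ', Module.End.mul_apply, toEnd_apply_apply]
      rw [leibniz_lie, t.lie_lie_smul_f ℂ, ih, neg_lie, smul_lie, lie_add, lie_smul]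
      push_cast
      module
  have he (k : ℕ) : ⁅e, ((toEnd ℂ L M f) ^ (k + 1)) y⁆ =
      ((k + 1) * (n - k) : ℂ) • ((toEnd ℂ L M f) ^ k) y +
        (k + 1 : ℂ) • ((toEnd ℂ L M f) ^ k) v := by
    induction k with
    | zero => simp [leibniz_lie e, t.lie_e_f, hey, hy]
    | succ k ih =>
      rw [pow_succ', Module.End.mul_apply, toEnd_apply_apply, leibniz_lie, t.lie_e_f, ih, hh,
        lie_add, lie_smul, lie_smul]
      simp only [pow_succ' _ k, Module.End.mul_apply, toEnd_apply_apply]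
      push_cast
      module
  have hfv := P.pow_toEnd_f_eq_zero_of_eq_nat rfl
  have hen := he n
  rw [sub_self, mul_zero, zero_smul, zero_add] at hen
  have hz : ((toEnd ℂ L M f) ^ (n + 1)) y = 0 := by
    refine t.eq_zero_of_lie_f_lie_e_eq_zero (n := n + 1) ?_ ?_
    · rw [hh, hfv, add_zero]
      congr 1
      push_cast
      ring
    · rw [hen, lie_smul, P.lie_f_pow_toEnd_f, hfv, smul_zero]
  rw [hz, lie_zero, eq_comm, smul_eq_zero_iff_right (by exact_mod_cast n.succ_ne_zero)] at hen
  exact P.pow_toEnd_f_ne_zero_of_eq_nat rfl le_rfl hen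

/-- In a finite-dimensional representation, the action of `h` has no Jordan block of size two. -/
lemma lie_h_eq_smul_of_lie_h_eq_add (t : IsSl2Triple h e f) {v y : M} {μ : ℂ}
    (hv : ⁅h, v⁆ = μ • v) (hy : ⁅h, y⁆ = μ • y + v) : v = 0 := by
  by_contra hv₀
  obtain ⟨k, hk, hk'⟩ := Nat.exists_not_and_succ_of_not_zero_of_exists
    (p := fun k ↦ ((toEnd ℂ L M e) ^ k) v = 0) (by simpa using hv₀)
    (t.exists_pow_toEnd_e_eq_zero hv)
  have hhv := t.lie_h_pow_toEnd_e hv k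
  have hev : ⁅e, ((toEnd ℂ L M e) ^ k) v⁆ = 0 := by rw [lie_e_pow_toEnd_e, hk']
  have hhy (j : ℕ) : ⁅h, ((toEnd ℂ L M e) ^ j) y⁆ =
      (μ + 2 * j) • ((toEnd ℂ L M e) ^ j) y + ((toEnd ℂ L M e) ^ j) v := by
    induction j with
    | zero => simpa using hy
    | succ j ih =>
      simp only [pow_succ', Module.End.mul_apply, toEnd_apply_apply]
      rw [leibniz_lie, t.lie_h_e_smul ℂ, ih, smul_lie, lie_add, lie_smul]
      push_cast
      module
  obtain ⟨n, hn⟩ := HasPrimitiveVectorWith.exists_nat (t := t) ⟨hk, hhv, hev⟩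
  obtain ⟨u, hu, heu⟩ := t.exists_lie_e_eq (n := n + 1) (z := ((toEnd ℂ L M e) ^ (k + 1)) y) <| by
    rw [hhy, hk', add_zero]
    congr 1
    push_cast
    linear_combination hn
  refine hk (t.eq_zero_of_lie_h_eq_add (y := ((toEnd ℂ L M e) ^ k) y - u) hhv hev ?_ ?_)
  · rw [lie_sub, hhy, hu, hn]
    push_cast
    module
  · rw [lie_sub, lie_e_pow_toEnd_e, heu, sub_self]

/-- In a finite-dimensional representation, each weight space of `h` is complementary to the
range of the corresponding shift of `h`. -/
lemma isCompl_eigenspace_range (t : IsSl2Triple h e f) (μ : ℂ) :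
    IsCompl ((toEnd ℂ L M h).eigenspace μ)
      (LinearMap.range (toEnd ℂ L M h - μ • (1 : Module.End ℂ M))) := by
  rw [Submodule.isCompl_iff_disjoint, Submodule.disjoint_def]
  · rintro v hv ⟨y, rfl⟩
    refine t.lie_h_eq_smul_of_lie_h_eq_add (y := y) (mem_eigenspace_iff.mp hv) ?_
    simp
  · rw [eigenspace_def, add_comm, LinearMap.finrank_range_add_finrank_ker]

end IsSl2Triple

/-- Let `𝔤` be a finite-dimensional complex Lie algebra with nondegenerate
Killing form `κ`, and let `(e, h, f)` be an `sl₂`-triple with `e ≠ 0`. Then the bilinear form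
`(x, y) ↦ κ(e, ⁅x, y⁆)` on the eigenspace `𝔤₋₁` of `ad h` with eigenvalue `-1` is alternating
and nondegenerate, i.e. `𝔤₋₁` carries a canonical symplectic form. -/
theorem minusOne_eigenspace_carries_symplectic_form
    {L : Type*} [LieRing L] [LieAlgebra ℂ L] [FiniteDimensional ℂ L]
    (hκ : (killingForm ℂ L).Nondegenerate)
    (e h f : L) (he : e ≠ 0)
    (hhe : ⁅h, e⁆ = (2 : ℂ) • e) (hhf : ⁅h, f⁆ = (-2 : ℂ) • f) (hef : ⁅e, f⁆ = h) :
    (∀ x : Module.End.eigenspace (LieAlgebra.ad ℂ L h) (-1),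
      killingForm ℂ L e ⁅(x : L), (x : L)⁆ = 0) ∧
    (∀ x : Module.End.eigenspace (LieAlgebra.ad ℂ L h) (-1),
      (∀ y : Module.End.eigenspace (LieAlgebra.ad ℂ L h) (-1),
        killingForm ℂ L e ⁅(x : L), (y : L)⁆ = 0) → x = 0) := by
  have t : IsSl2Triple h e f :=
    { h_ne_zero := by
        rintro rfl
        exact he (by simpa using hhe.symm)
      lie_e_f := hef
      lie_h_e_nsmul := by rw [hhe, two_smul, two_nsmul]
      lie_h_f_nsmul := by rw [hhf, neg_smul, two_smul, two_nsmul] }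
  refine ⟨fun x ↦ by simp, fun x hx ↦ Subtype.ext ?_⟩
  have hhx : ⁅h, (x : L)⁆ = (-1 : ℂ) • (x : L) := Module.End.mem_eigenspace_iff.mp x.2
  have hhex : ⁅h, ⁅e, (x : L)⁆⁆ = ⁅e, (x : L)⁆ := by
    rw [leibniz_lie, hhe, hhx, smul_lie, lie_smul]
    module
  have hex : ⁅e, (x : L)⁆ = 0 := by
    refine hκ.1 _ fun z ↦ ?_
    obtain ⟨y, hy, w, ⟨r, rfl⟩, rfl⟩ := Submodule.mem_sup.mp <|
      (t.isCompl_eigenspace_range (M := L) (-1)).sup_eq_top ▸ Submodule.mem_top (x := z)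
    have hr : killingForm ℂ L ⁅e, (x : L)⁆ ⁅h, r⁆ = -killingForm ℂ L ⁅e, (x : L)⁆ r := by
      rw [← LieModule.traceForm_apply_lie_apply, ← lie_skew, hhex, map_neg, LinearMap.neg_apply]
    rw [map_add, LieModule.traceForm_apply_lie_apply, hx ⟨y, hy⟩]
    simp [hr]
  exact t.eq_zero_of_lie_f_lie_e_eq_zero (n := 0) (by simpa using hhx) (by rw [hex, lie_zero])
end

section
/- Let 𝔤 be a finite-dimensional complex Lie algebra whose Killing form κ is nondegenerate, and let (e, h, f) be an sl₂-triple in 𝔤 with e ≠ 0. Let 𝔫 = 𝔤_{≤−1} be the sum of the eigenspaces 𝔤_i of ad h over integers i ≤ −1, and let 𝔎(e) = {x ∈ 𝔤_{≤−2} : κ(e, x) = 0} be the kernel of the Killing pairing with e on 𝔤_{≤−2}, where 𝔤_{≤−2} is the sum of the 𝔤_i over i ≤ −2. Then 𝔎(e) is a Lie ideal of 𝔫, and the quotient 𝔫/𝔎(e) has dimension dim 𝔤_{−1} + 1. -/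
open Module Module.End in
/-- The eigenvalues of `h` on a finite-dimensional representation of an `sl₂`-triple are
integers. -/
lemma IsSl2Triple.exists_int_of_hasEigenvalue {K L M : Type*} [Field K] [CharZero K]
    [LieRing L] [LieAlgebra K L] [AddCommGroup M] [Module K M] [LieRingModule L M]
    [LieModule K L M] [FiniteDimensional K M] {h e f : L} (t : IsSl2Triple h e f) {μ : K}
    (hμ : (LieModule.toEnd K L M h).HasEigenvalue μ) : ∃ n : ℤ, μ = n := by
  obtain ⟨m, hm⟩ := hμ.exists_hasEigenvector
  have hev := t.lie_h_pow_toEnd_e (R := K) hm.apply_eq_smul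
  have hzero : ∃ k, ((LieModule.toEnd K L M e) ^ k) m = 0 := by
    by_contra! contra
    have hinj : Function.Injective fun n : ℕ ↦ μ + 2 * (n : K) := fun a b hab ↦ by
      simpa using hab
    exact not_finite_iff_infinite.mpr inferInstance <| LinearIndependent.finite (R := K) <|
      eigenvectors_linearIndependent' (LieModule.toEnd K L M h) _ hinj _
        fun n ↦ ⟨mem_eigenspace_iff.mpr (hev n), contra n⟩
  obtain ⟨n, hn, hn'⟩ := Nat.exists_not_and_succ_of_not_zero_of_exists
    (p := fun k ↦ ((LieModule.toEnd K L M e) ^ k) m = 0) hm.2 hzero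
  obtain ⟨k, hk⟩ := IsSl2Triple.HasPrimitiveVectorWith.exists_nat (t := t)
    ⟨hn, hev n, by rwa [lie_e_pow_toEnd_e n]⟩
  exact ⟨k - 2 * n, by push_cast; linear_combination hk⟩

open Module Module.End in
/-- If `T` is a complex endomorphism with integer eigenvalues such that `T ^ 2` has trace zero,
then all the eigenvalues of `T` are zero. -/
lemma Module.End.eq_zero_of_trace_mul_self_eq_zero {V : Type*} [AddCommGroup V] [Module ℂ V]
    [FiniteDimensional ℂ V] {T : End ℂ V} (hT : ∀ μ, T.HasEigenvalue μ → ∃ n : ℤ, μ = n)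
    (htr : LinearMap.trace ℂ V (T * T) = 0) {μ : ℂ} (hμ : T.HasEigenvalue μ) : μ = 0 := by
  have hsq : ∀ r ∈ (T * T).charpoly.roots, ∃ n : ℤ, r = (n : ℂ) ^ 2 := by
    intro r hr
    obtain ⟨v, hv⟩ := ((hasEigenvalue_iff_isRoot_charpoly _ _).mpr
      (Polynomial.isRoot_of_mem_roots hr)).exists_hasEigenvector
    obtain ⟨s, rfl⟩ := IsAlgClosed.exists_pow_nat_eq r two_pos
    have hTT : T (T v) = s ^ 2 • v := hv.apply_eq_smul
    by_cases hw : T v + s • v = 0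
    · obtain ⟨n, hn⟩ := hT (-s) <| hasEigenvalue_of_hasEigenvector (x := v)
        ⟨mem_eigenspace_iff.mpr (by rw [neg_smul]; exact eq_neg_of_add_eq_zero_left hw), hv.2⟩
      exact ⟨n, by rw [← hn]; ring⟩
    · obtain ⟨n, hn⟩ := hT s <| hasEigenvalue_of_hasEigenvector (x := T v + s • v)
        ⟨mem_eigenspace_iff.mpr (by rw [map_add, map_smul, hTT]; module), hw⟩
      exact ⟨n, by rw [hn]⟩
  have hsum : ((T * T).charpoly.roots.map Complex.re).sum = 0 := by
    rw [trace_eq_sum_roots_charpoly_of_splits (IsAlgClosed.splits _)] at htr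
    have := congrArg Complex.reAddGroupHom htr
    rwa [map_multiset_sum, map_zero] at this
  have hnonneg : ∀ x ∈ (T * T).charpoly.roots.map Complex.re, 0 ≤ x := by
    intro x hx
    obtain ⟨r, hr, rfl⟩ := Multiset.mem_map.mp hx
    obtain ⟨n, rfl⟩ := hsq r hr
    norm_cast
    positivity
  obtain ⟨v, hv⟩ := hμ.exists_hasEigenvector
  have hroot : μ ^ 2 ∈ (T * T).charpoly.roots := by
    rw [Polynomial.mem_roots (LinearMap.charpoly_monic _).ne_zero,
      ← hasEigenvalue_iff_isRoot_charpoly]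
    refine hasEigenvalue_of_hasEigenvector (x := v) ⟨mem_eigenspace_iff.mpr ?_, hv.2⟩
    rw [mul_apply, hv.apply_eq_smul, map_smul, hv.apply_eq_smul, smul_smul, sq]
  have hre := Multiset.all_zero_of_le_zero_le_of_sum_eq_zero hnonneg hsum _
    (Multiset.mem_map_of_mem Complex.re hroot)
  obtain ⟨n, rfl⟩ := hT μ hμ
  norm_cast at hre ⊢
  exact pow_eq_zero_iff two_ne_zero |>.mp hre

open Module.End in
/-- For an `sl₂`-triple in a finite-dimensional complex Lie algebra, the Killing form pairs `e`
and `f` nontrivially. -/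
lemma IsSl2Triple.killingForm_e_f_ne_zero {L : Type*} [LieRing L] [LieAlgebra ℂ L]
    [FiniteDimensional ℂ L] {h e f : L} (t : IsSl2Triple h e f) : killingForm ℂ L e f ≠ 0 := by
  intro h0
  have hhh : killingForm ℂ L h h = 0 := by
    nth_rw 1 [← t.lie_e_f]
    rw [LieModule.traceForm_apply_lie_apply, ← lie_skew, t.lie_lie_smul_f ℂ, neg_neg, map_smul, h0,
      smul_zero]
  have h2 : (LieAlgebra.ad ℂ L h).HasEigenvalue 2 :=
    hasEigenvalue_of_hasEigenvector (x := e)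
      ⟨mem_eigenspace_iff.mpr (t.lie_h_e_smul ℂ), t.e_ne_zero⟩
  exact two_ne_zero <| eq_zero_of_trace_mul_self_eq_zero
    (fun μ hμ ↦ t.exists_int_of_hasEigenvalue hμ) hhh h2

open Module.End in
/-- The bracket adds eigenvalues of `ad h`. -/
lemma LieAlgebra.lie_mem_eigenspace_ad {R L : Type*} [CommRing R] [LieRing L] [LieAlgebra R L]
    {h x y : L} {a b : R} (hx : x ∈ eigenspace (ad R L h) a) (hy : y ∈ eigenspace (ad R L h) b) :
    ⁅x, y⁆ ∈ eigenspace (ad R L h) (a + b) := by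
  rw [mem_eigenspace_iff, ad_apply] at *
  rw [leibniz_lie, hx, hy, smul_lie, lie_smul, add_smul]

open Module.End in
/-- Eigenspaces of `ad h` whose eigenvalues do not sum to zero are orthogonal for the Killing
form. -/
lemma LieAlgebra.killingForm_eq_zero_of_mem_eigenspace_ad {K L : Type*} [Field K] [LieRing L]
    [LieAlgebra K L] {h x y : L} {a b : K} (hx : x ∈ eigenspace (ad K L h) a)
    (hy : y ∈ eigenspace (ad K L h) b) (hab : a + b ≠ 0) : killingForm K L x y = 0 := by
  rw [mem_eigenspace_iff, ad_apply] at *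
  have := LieModule.traceForm_apply_lie_apply' K L L h x y
  rw [hx, hy, map_smul, map_smul, LinearMap.smul_apply, smul_eq_mul, smul_eq_mul] at this
  refine (mul_eq_zero.mp ?_).resolve_left hab
  linear_combination this

/-- Intersecting with the kernel of a linear form that does not vanish on `G` lowers the dimension
of `G` by one. -/
lemma Submodule.finrank_inf_ker_add_one {K V : Type*} [Field K] [AddCommGroup V] [Module K V]
    [FiniteDimensional K V] (G : Submodule K V) (φ : Module.Dual K V) {x : V} (hx : x ∈ G)
    (hφ : φ x ≠ 0) :
    Module.finrank K (G ⊓ LinearMap.ker φ : Submodule K V) + 1 = Module.finrank K G := by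
  have hne : φ.comp G.subtype ≠ 0 := fun h ↦ hφ (LinearMap.congr_fun h ⟨x, hx⟩)
  rw [← Module.Dual.finrank_ker_add_one_of_ne_zero hne, inf_comm, LinearMap.ker_comp,
    ← (Submodule.comapSubtypeEquivOfLe (inf_le_right : LinearMap.ker φ ⊓ G ≤ G)).finrank_eq,
    Submodule.comap_inf, Submodule.comap_subtype_self, inf_top_eq]


/-- Let `𝔤` be a finite-dimensional complex Lie algebra with nondegenerate
Killing form `κ`, and `(e, h, f)` an `sl₂`-triple with `e ≠ 0`. Let `𝔫 = 𝔤_{≤ -1}` be the sum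
of the eigenspaces `𝔤ᵢ` of `ad h` over `i ≤ -1`, and let
`𝔎(e) = {x ∈ 𝔤_{≤ -2} : κ(e, x) = 0}` be the kernel of the Killing pairing with `e` on
`𝔤_{≤ -2}`. Then `𝔎(e)` is a Lie ideal of `𝔫` (it is contained in `𝔫` and
`⁅𝔫, 𝔎(e)⁆ ⊆ 𝔎(e)`), and the quotient `𝔫 ⧸ 𝔎(e)` has dimension `dim 𝔤₋₁ + 1`. -/
theorem killing_kernel_is_ideal_of_codim_dim_gminus1_add_one
    {L : Type*} [LieRing L] [LieAlgebra ℂ L] [FiniteDimensional ℂ L]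
    (hκ : (killingForm ℂ L).Nondegenerate)
    (e h f : L) (he : e ≠ 0)
    (hhe : ⁅h, e⁆ = (2 : ℂ) • e) (hhf : ⁅h, f⁆ = (-2 : ℂ) • f) (hef : ⁅e, f⁆ = h)
    (N : Submodule ℂ L)
    (hN : N = ⨆ i ∈ Set.Iic (-1 : ℤ), Module.End.eigenspace (LieAlgebra.ad ℂ L h) (i : ℂ))
    (K : Submodule ℂ L)
    (hK : K = (⨆ i ∈ Set.Iic (-2 : ℤ), Module.End.eigenspace (LieAlgebra.ad ℂ L h) (i : ℂ)) ⊓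
      LinearMap.ker (killingForm ℂ L e)) :
    K ≤ N ∧
    (∀ x ∈ N, ∀ y ∈ K, ⁅x, y⁆ ∈ K) ∧
    Module.finrank ℂ (N ⧸ Submodule.comap N.subtype K) =
      Module.finrank ℂ (Module.End.eigenspace (LieAlgebra.ad ℂ L h) (-1 : ℂ)) + 1 := by
  set E : ℤ → Submodule ℂ L := fun i ↦ Module.End.eigenspace (LieAlgebra.ad ℂ L h) (i : ℂ) with hE
  have t : IsSl2Triple h e f :=
    { h_ne_zero := by
        rintro rfl
        exact he (by simpa using hhe.symm)
      lie_e_f := hef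
      lie_h_e_nsmul := by rw [hhe, ofNat_smul_eq_nsmul]
      lie_h_f_nsmul := by rw [hhf, neg_smul, ofNat_smul_eq_nsmul] }
  have heE : e ∈ Module.End.eigenspace (LieAlgebra.ad ℂ L h) 2 := Module.End.mem_eigenspace_iff.mpr hhe
  set G : Submodule ℂ L := ⨆ i ∈ Set.Iic (-2 : ℤ), E i with hG
  have hEG {i : ℤ} (hi : i ≤ -2) : E i ≤ G := le_biSup E (Set.mem_Iic.mpr hi)
  have hIic : Set.Iic (-1 : ℤ) = insert (-1) (Set.Iic (-2)) := by
    ext i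
    simp only [Set.mem_Iic, Set.mem_insert_iff]
    lia
  have hNsup : N = E (-1) ⊔ G := by rw [hN, hIic, iSup_insert]
  have hdisj : Disjoint (E (-1)) G :=
    ((Module.End.eigenspaces_iSupIndep (LieAlgebra.ad ℂ L h)).comp Int.cast_injective).disjoint_biSup
      (by simp)
  have hKG : K ≤ G := hK.trans_le inf_le_left
  have hKN : K ≤ N := hKG.trans (hNsup ▸ le_sup_right)
  have hlie (i j : ℤ) (hi : i ≤ -1) (hj : j ≤ -2) {x y : L} (hx : x ∈ E i) (hy : y ∈ E j) :
      ⁅x, y⁆ ∈ K := by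
    have hxy : ⁅x, y⁆ ∈ E (i + j) := by
      simpa [hE] using LieAlgebra.lie_mem_eigenspace_ad hx hy
    rw [hK]
    refine ⟨hEG (by lia) hxy, LieAlgebra.killingForm_eq_zero_of_mem_eigenspace_ad heE hxy ?_⟩
    norm_cast
    lia
  refine ⟨hKN, fun x hx y hy ↦ ?_, ?_⟩
  · replace hy := hKG hy
    have hNG : N ≤ ⨆ i ∈ Set.Iic (-1 : ℤ), E i := hN.le
    have hGle : G ≤ K.comap (LieAlgebra.ad ℂ L x) := by
      refine iSup₂_le fun j hj z hz ↦ ?_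
      have hNle : N ≤ K.comap (LieAlgebra.ad ℂ L z) :=
        hNG.trans <| iSup₂_le fun i hi w hw ↦ by
          rw [Submodule.mem_comap, LieAlgebra.ad_apply, ← lie_skew]
          exact neg_mem (hlie i j hi hj hw hz)
      rw [Submodule.mem_comap, LieAlgebra.ad_apply, ← lie_skew]
      exact neg_mem (hNle hx)
    exact hGle hy
  · have hφ := t.killingForm_e_f_ne_zero
    have hfG : f ∈ G := hEG le_rfl (Module.End.mem_eigenspace_iff.mpr (by simpa using hhf))
    have h1 := G.finrank_inf_ker_add_one (killingForm ℂ L e) hfG hφ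
    rw [← hK] at h1
    have h2 := Submodule.finrank_sup_add_finrank_inf_eq (E (-1)) G
    rw [hdisj.eq_bot, finrank_bot, ← hNsup] at h2
    have h3 := Submodule.finrank_quotient_add_finrank (K.comap N.subtype)
    rw [(Submodule.comapSubtypeEquivOfLe hKN).finrank_eq] at h3
    have h4 : E (-1) = Module.End.eigenspace (LieAlgebra.ad ℂ L h) (-1 : ℂ) := by simp [hE]
    rw [← h4]
    lia
end
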